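/- Suppose Assumptions 1–4, 6 and 7 below hold (with δ_H ∈ [0,1]). Then for every t ≥ 0, almost surely: E[‖x̂_{t+1}‖⁴ | F_t] ≤ (1 − μ_Fα_t)‖x̂_t‖⁴ + 24L_H L_{G,y} β_t‖x̂_t‖³‖ŷ_t‖ + 40L_H²L_{G,y}²β_t²‖x̂_t‖²‖ŷ_t‖² + 1280L_H⁴L_{G,y}⁴β_t⁴‖ŷ_t‖⁴ + 32α_t⁴Γ₁₁² + 224L_H⁴β_t⁴Γ₂₂² + (20Γ₁₁α_t² + 20L_H²Γ₂₂β_t² + (64S_H²Γ₂₂^{1+δ_H}/μ_F)·β_t^{2+2δ_H}/α_t)·‖x̂_t‖². -/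

import Mathlib

set_option autoImplicit false

open MeasureTheory Filter
open scoped RealInnerProductSpace

noncomputable section

/-- Spectral norm of a rectangular real matrix (the operator norm of the induced
linear map between Euclidean spaces). -/
def specNorm {m n : ℕ} (A : Matrix (Fin m) (Fin n) ℝ) : ℝ :=
  ‖LinearMap.toContinuousLinearMap (Matrix.toEuclideanLin A)‖

/-- The σ-algebra `𝔉 t = σ(x₀, y₀, ξ₀, ψ₀, …, ξ_{t-1}, ψ_{t-1})`. -/
def natFilt {Ω : Type} [MeasurableSpace Ω] {dx dy : ℕ}
    (x0 : Ω → EuclideanSpace ℝ (Fin dx)) (y0 : Ω → EuclideanSpace ℝ (Fin dy))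
    (ξ : ℕ → Ω → EuclideanSpace ℝ (Fin dx)) (ψ : ℕ → Ω → EuclideanSpace ℝ (Fin dy))
    (t : ℕ) : MeasurableSpace Ω :=
  MeasurableSpace.comap x0 inferInstance ⊔ MeasurableSpace.comap y0 inferInstance ⊔
    ⨆ s ∈ Finset.range t,
      (MeasurableSpace.comap (ξ s) inferInstance ⊔ MeasurableSpace.comap (ψ s) inferInstance)

set_option maxHeartbeats 800000 in
lemma poly_bound {m X q U a b c n : ℝ} (hm : 0 < m) (hm' : m ≤ 1 / 12) (hX : 0 ≤ X)
    (hq : 0 ≤ q) (hU : 0 ≤ U) (ha : 0 ≤ a) (hb : 0 ≤ b) (hc : 0 ≤ c) (hn : 0 ≤ n)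
    (hcb : c ≤ 2 * b) (hnab : n ≤ a + b) (hUX : U ≤ (1 - 87 / 100 * m) * X + q) :
    U ^ 4 + 4 * U ^ 3 * c + 8 * U ^ 2 * n ^ 2 + 3 * n ^ 4 ≤
      (1 - m) * X ^ 4 + 24 * q * X ^ 3 + 40 * q ^ 2 * X ^ 2 + 1280 * q ^ 4 +
        X ^ 2 * (20 * a ^ 2 + 20 * b ^ 2 + 64 / m * c ^ 2) + (32 * a ^ 4 + 224 * b ^ 4) := by
  have hp0 : 0 ≤ 1 - 87 / 100 * m := by linarith
  have hUq : U ≤ X + q := hUX.trans (by nlinarith [mul_nonneg hm.le hX])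
  have h1 : U ^ 4 ≤ (1 - 3 / 2 * m) * X ^ 4 + 4 * q * X ^ 3 + 8 * q ^ 2 * X ^ 2 + 3 * q ^ 4 := by
    set p := 1 - 87 / 100 * m with hp
    have hp1 : p ≤ 1 := by rw [hp]; linarith
    have hp2 : p ^ 2 ≤ 1 - 3 / 2 * m := by rw [hp]; nlinarith
    have hpX : p * X ≤ X := by nlinarith
    have hpX0 : 0 ≤ p * X := mul_nonneg hp0 hX
    have hp4 : p ^ 4 ≤ 1 - 3 / 2 * m := by nlinarith [sq_nonneg p]
    calc U ^ 4 ≤ (p * X + q) ^ 4 := by gcongr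
      _ = p ^ 4 * X ^ 4 + 4 * q * (p * X) ^ 3 + 6 * q ^ 2 * (p * X) ^ 2
          + 4 * q ^ 3 * (p * X) + q ^ 4 := by ring
      _ ≤ (1 - 3 / 2 * m) * X ^ 4 + 4 * q * X ^ 3 + 6 * q ^ 2 * X ^ 2
          + 4 * q ^ 3 * X + q ^ 4 := by gcongr
      _ ≤ _ := by nlinarith [mul_nonneg (sq_nonneg q) (sq_nonneg (X - q))]
  have h2 : 4 * U ^ 3 * c ≤ m / 2 * X ^ 4 + 9 * (c ^ 2 / m * X ^ 2) + 6 * q ^ 2 * X ^ 2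
      + 12 * q ^ 4 + 2 * b ^ 4 := by
    have e1 : 4 * c * X ^ 3 ≤ m / 2 * X ^ 4 + 8 * (c ^ 2 / m * X ^ 2) := by
      have : m / 2 * X ^ 4 + 8 * (c ^ 2 / m * X ^ 2) - 4 * c * X ^ 3
          = (m * X ^ 2 - 4 * (c * X)) ^ 2 / (2 * m) := by field_simp; ring
      have h : 0 ≤ (m * X ^ 2 - 4 * (c * X)) ^ 2 / (2 * m) := by positivity
      linarith
    have e2 : 12 * c ^ 2 * X ^ 2 ≤ c ^ 2 / m * X ^ 2 := by
      have : 12 * c ^ 2 ≤ c ^ 2 / m := by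
        rw [le_div_iff₀ hm]; nlinarith [sq_nonneg c]
      gcongr
    have e3 : 4 * c * q ^ 3 ≤ 6 * q ^ 4 + 2 * b ^ 4 := by
      have : c * q ^ 3 ≤ 2 * b * q ^ 3 := by gcongr
      nlinarith [sq_nonneg (q ^ 2 - b ^ 2), mul_nonneg (sq_nonneg q) (sq_nonneg (q - b))]
    calc 4 * U ^ 3 * c ≤ 4 * (X + q) ^ 3 * c := by gcongr
      _ = 4 * c * X ^ 3 + 12 * (c * X) * (q * X) + 12 * (c * X) * q ^ 2 + 4 * c * q ^ 3 := by ring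
      _ ≤ _ := by nlinarith [sq_nonneg (c * X - q * X), sq_nonneg (c * X - q ^ 2)]
  have hn2 : n ^ 2 ≤ 2 * a ^ 2 + 2 * b ^ 2 := by nlinarith [sq_nonneg (a - b)]
  have h3 : 8 * U ^ 2 * n ^ 2 ≤ X ^ 2 * (20 * a ^ 2 + 20 * b ^ 2) + 8 * a ^ 4 + 80 * b ^ 4
      + 220 * q ^ 4 := by
    have hU2 : U ^ 2 ≤ 5 / 4 * X ^ 2 + 5 * q ^ 2 := by nlinarith [sq_nonneg (X - 4 * q)]
    calc 8 * U ^ 2 * n ^ 2 ≤ 8 * (5 / 4 * X ^ 2 + 5 * q ^ 2) * (2 * a ^ 2 + 2 * b ^ 2) := by gcongr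
      _ ≤ _ := by nlinarith [sq_nonneg (a ^ 2 - 5 * q ^ 2), sq_nonneg (2 * b ^ 2 - q ^ 2)]
  have h4 : 3 * n ^ 4 ≤ 24 * a ^ 4 + 24 * b ^ 4 := by
    have : n ^ 4 ≤ (2 * a ^ 2 + 2 * b ^ 2) ^ 2 := by
      calc n ^ 4 = (n ^ 2) ^ 2 := by ring
        _ ≤ _ := by gcongr
    nlinarith [sq_nonneg (a ^ 2 - b ^ 2)]
  have e : 64 / m * c ^ 2 = 64 * (c ^ 2 / m) := by ring
  have p1 : 0 ≤ q * X ^ 3 := by positivity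
  have p2 : 0 ≤ q ^ 2 * X ^ 2 := by positivity
  have p3 : 0 ≤ c ^ 2 / m * X ^ 2 := by positivity
  have p4 : 0 ≤ q ^ 4 := by positivity
  have p5 : 0 ≤ b ^ 4 := by positivity
  rw [e]
  nlinarith

lemma norm_add_pow_four_le {E : Type*} [NormedAddCommGroup E] [InnerProductSpace ℝ E]
    (u M R : E) :
    ‖u + (M + R)‖ ^ 4 ≤ ‖u‖ ^ 4 + 4 * ‖u‖ ^ 2 * ⟪u, M⟫ + 4 * ‖u‖ ^ 3 * ‖R‖
      + 8 * ‖u‖ ^ 2 * ‖M + R‖ ^ 2 + 3 * ‖M + R‖ ^ 4 := by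
  set N := M + R with hN
  have h1 : ‖u + N‖ ^ 4 = (‖u‖ ^ 2 + 2 * ⟪u, N⟫ + ‖N‖ ^ 2) ^ 2 := by
    rw [← norm_add_sq_real]; ring
  have h2 : |⟪u, N⟫| ≤ ‖u‖ * ‖N‖ := abs_real_inner_le_norm u N
  have h3 : ⟪u, N⟫ = ⟪u, M⟫ + ⟪u, R⟫ := by rw [hN, inner_add_right]
  have h4 : ⟪u, R⟫ ≤ ‖u‖ * ‖R‖ := real_inner_le_norm u R
  have h5 : ⟪u, N⟫ ^ 2 ≤ (‖u‖ * ‖N‖) ^ 2 := sq_le_sq' (by linarith [(abs_le.1 h2).1]) (abs_le.1 h2).2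
  have h6 : ⟪u, N⟫ * ‖N‖ ^ 2 ≤ ‖u‖ * ‖N‖ * ‖N‖ ^ 2 := by gcongr; exact (abs_le.1 h2).2
  have h7 : ‖u‖ ^ 2 * ⟪u, N⟫ ≤ ‖u‖ ^ 2 * ⟪u, M⟫ + ‖u‖ ^ 2 * (‖u‖ * ‖R‖) := by
    rw [h3, mul_add]; gcongr
  rw [h1]
  nlinarith [mul_nonneg (sq_nonneg ‖N‖) (sq_nonneg (‖u‖ - ‖N‖))]

lemma memLp_four_iff {Ω E : Type*} [MeasurableSpace Ω] {μ : Measure Ω} [NormedAddCommGroup E]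
    {f : Ω → E} (hf : AEStronglyMeasurable f μ) :
    MemLp f 4 μ ↔ Integrable (fun ω => ‖f ω‖ ^ 4) μ := by
  rw [← integrable_norm_rpow_iff hf (by norm_num) (by norm_num)]
  simp only [ENNReal.toReal_ofNat, Real.rpow_ofNat]

lemma MeasureTheory.MemLp.integrable_mul_four {Ω : Type*} [MeasurableSpace Ω] {μ : Measure Ω}
    {f₁ f₂ f₃ f₄ : Ω → ℝ} (h₁ : MemLp f₁ 4 μ) (h₂ : MemLp f₂ 4 μ) (h₃ : MemLp f₃ 4 μ)
    (h₄ : MemLp f₄ 4 μ) : Integrable (fun ω => f₁ ω * f₂ ω * f₃ ω * f₄ ω) μ := by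
  have i₁ := (memLp_four_iff h₁.1).1 h₁
  have i₂ := (memLp_four_iff h₂.1).1 h₂
  have i₃ := (memLp_four_iff h₃.1).1 h₃
  have i₄ := (memLp_four_iff h₄.1).1 h₄
  refine (((i₁.add i₂).add i₃).add i₄).mono' (((h₁.1.mul h₂.1).mul h₃.1).mul h₄.1) ?_
  refine ae_of_all _ fun ω => ?_
  simp only [Pi.add_apply, norm_mul]
  generalize ‖f₁ ω‖ = a, ‖f₂ ω‖ = b, ‖f₃ ω‖ = c, ‖f₄ ω‖ = d
  nlinarith [sq_nonneg (a * b - c * d), sq_nonneg (a ^ 2 - b ^ 2), sq_nonneg (c ^ 2 - d ^ 2),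
    sq_nonneg (a ^ 2), sq_nonneg (b ^ 2), sq_nonneg (c ^ 2), sq_nonneg (d ^ 2)]

/-- Conditional Jensen inequality for a concave power. -/
lemma condExp_rpow_le {Ω : Type*} {m mΩ : MeasurableSpace Ω} {μ : Measure Ω} [IsFiniteMeasure μ]
    (hm : m ≤ mΩ) {f : Ω → ℝ} (hf : Integrable f μ) (hf0 : ∀ ω, 0 ≤ f ω) {s C : ℝ}
    (hs : 0 < s) (hs1 : s ≤ 1) (hC : ∀ᵐ ω ∂μ, (μ[f | m]) ω ≤ C) :
    Integrable (fun ω => f ω ^ s) μ ∧ ∀ᵐ ω ∂μ, (μ[fun ω => f ω ^ s | m]) ω ≤ C ^ s := by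
  have hint : Integrable (fun ω => f ω ^ s) μ := by
    refine (hf.add (integrable_const 1)).mono'
      ((Real.continuous_rpow_const hs.le).comp_aestronglyMeasurable hf.1) (ae_of_all _ fun ω => ?_)
    have h0 := hf0 ω
    rw [Real.norm_of_nonneg (Real.rpow_nonneg h0 s), Pi.add_apply]
    have := rpow_one_add_le_one_add_mul_self (s := f ω - 1) (by linarith) hs.le hs1
    rw [add_sub_cancel] at this
    nlinarith
  refine ⟨hint, ?_⟩
  have hJ := ConcaveOn.condExp_map_le hm (Real.concaveOn_rpow hs.le hs1)
    (Real.continuous_rpow_const hs.le).continuousOn.upperSemicontinuousOn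
    (ae_of_all μ hf0) isClosed_Ici hf hint
  have h0 : 0 ≤ᵐ[μ] μ[f | m] := condExp_nonneg (ae_of_all _ hf0)
  filter_upwards [hJ, hC, h0] with ω h1 h2 h3
  exact h1.trans (Real.rpow_le_rpow h3 h2 hs.le)

lemma condExp_inner_eq_zero {Ω E : Type*} {m mΩ : MeasurableSpace Ω} {μ : Measure Ω}
    [NormedAddCommGroup E] [InnerProductSpace ℝ E] [CompleteSpace E] {w ξ : Ω → E}
    (hw : StronglyMeasurable[m] w) (hξ : Integrable ξ μ)
    (hwξ : Integrable (fun ω => ⟪w ω, ξ ω⟫) μ) (h0 : μ[ξ | m] =ᵐ[μ] 0) :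
    μ[fun ω => ⟪w ω, ξ ω⟫ | m] =ᵐ[μ] 0 := by
  filter_upwards [condExp_bilin_of_stronglyMeasurable_left (innerSL ℝ) hw hwξ hξ, h0] with ω h1 h2
  exact h1.trans (by simp [h2])

lemma condExp_le_of_le_add_inner {Ω E E' : Type*} {m mΩ : MeasurableSpace Ω} {μ : Measure Ω}
    [IsFiniteMeasure μ]
    [NormedAddCommGroup E] [InnerProductSpace ℝ E] [CompleteSpace E]
    [NormedAddCommGroup E'] [InnerProductSpace ℝ E'] [CompleteSpace E']
    (hm : m ≤ mΩ) {Z K P S S' V : Ω → ℝ} {w ξ : Ω → E} {w' ψ : Ω → E'} {s v : ℝ}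
    (hZ : Integrable Z μ) (hK : Integrable K μ) (hKm : StronglyMeasurable[m] K)
    (hP0 : ∀ ω, 0 ≤ P ω) (hPm : StronglyMeasurable[m] P)
    (hPS : Integrable (fun ω => P ω * S ω) μ) (hS : Integrable S μ) (hS' : Integrable S' μ)
    (hV : Integrable V μ) (hSS' : ∀ ω, S ω ≤ S' ω)
    (hs : ∀ᵐ ω ∂μ, (μ[S' | m]) ω ≤ s) (hv : ∀ᵐ ω ∂μ, (μ[V | m]) ω ≤ v)
    (hwm : StronglyMeasurable[m] w) (hξ : Integrable ξ μ)
    (hwξ : Integrable (fun ω => ⟪w ω, ξ ω⟫) μ) (hξ0 : μ[ξ | m] =ᵐ[μ] 0)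
    (hwm' : StronglyMeasurable[m] w') (hψ : Integrable ψ μ)
    (hwψ : Integrable (fun ω => ⟪w' ω, ψ ω⟫) μ) (hψ0 : μ[ψ | m] =ᵐ[μ] 0)
    (hle : ∀ ω, Z ω ≤ K ω + P ω * S ω + V ω + ⟪w ω, ξ ω⟫ + ⟪w' ω, ψ ω⟫) :
    ∀ᵐ ω ∂μ, (μ[Z | m]) ω ≤ K ω + P ω * s + v := by
  have h1 := hK.add hPS
  have h2 := h1.add hV
  have h3 := h2.add hwξ
  have h4 := h3.add hwψ
  filter_upwards [condExp_mono (m := m) hZ h4 (ae_of_all _ hle), condExp_add h3 hwψ m,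
    condExp_add h2 hwξ m, condExp_add h1 hV m, condExp_add hK hPS m,
    condExp_mul_of_stronglyMeasurable_left hPm hPS hS,
    condExp_mono (m := m) hS hS' (ae_of_all _ hSS'), hs, hv,
    condExp_inner_eq_zero hwm hξ hwξ hξ0, condExp_inner_eq_zero hwm' hψ hwψ hψ0]
    with ω a1 a2 a3 a4 a5 a6 a7 a8 a9 a10 a11
  rw [a2, Pi.add_apply, a3, Pi.add_apply, a4, Pi.add_apply, a5, Pi.add_apply, a10, a11,
    condExp_of_stronglyMeasurable hm hKm hK] at a1
  have a6' : (μ[fun ω => P ω * S ω | m]) ω = P ω * (μ[S | m]) ω := a6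
  rw [a6'] at a1
  have := mul_le_mul_of_nonneg_left (a7.trans a8) (hP0 ω)
  simp only [Pi.zero_apply] at a1
  linarith

/-- The consequences of the regularity and step-size assumptions that enter one step of the
recursion with step sizes `α`, `β`. -/
structure StepRegularity {E E' : Type*} [NormedAddCommGroup E] [InnerProductSpace ℝ E]
    [NormedAddCommGroup E'] [InnerProductSpace ℝ E'] (F : E → E' → E) (G : E → E' → E')
    (H : E' → E) (H' : E' → E' →L[ℝ] E) (ystar : E') (LH LF LGx LGy muF SH dH α β : ℝ) : Prop where
  LH_nonneg : 0 ≤ LH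
  LF_nonneg : 0 ≤ LF
  LGx_nonneg : 0 ≤ LGx
  LGy_nonneg : 0 ≤ LGy
  SH_nonneg : 0 ≤ SH
  dH_mem : dH ∈ Set.Icc (0 : ℝ) 1
  muF_pos : 0 < muF
  α_pos : 0 < α
  β_pos : 0 < β
  lipschitz_H : ∀ y₁ y₂, ‖H y₁ - H y₂‖ ≤ LH * ‖y₁ - y₂‖
  norm_F_le : ∀ x y, ‖F x y‖ ≤ LF * ‖x - H y‖
  norm_G_le : ∀ x y, ‖G x y‖ ≤ LGx * ‖x - H y‖ + LGy * ‖y - ystar‖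
  strong_mono : ∀ x y, muF * ‖x - H y‖ ^ 2 ≤ ⟪x - H y, F x y⟫
  hasFDerivAt_H : ∀ y, HasFDerivAt H (H' y) y
  taylor_H : ∀ y₁ y₂, ‖H y₁ - H y₂ - H' y₂ (y₁ - y₂)‖ ≤ SH * ‖y₁ - y₂‖ ^ (1 + dH)
  α_mul_sq_le : α * LF ^ 2 ≤ muF / 4
  muF_mul_α_le : muF * α ≤ 1 / 12
  coupling : Subsingleton E' ∨ LH * LGx * β ≤ muF * α / 200

namespace StepRegularity

variable {E E' : Type*} [NormedAddCommGroup E] [InnerProductSpace ℝ E]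
    [NormedAddCommGroup E'] [InnerProductSpace ℝ E'] {F : E → E' → E} {G : E → E' → E'}
    {H : E' → E} {H' : E' → E' →L[ℝ] E} {ystar : E'} {LH LF LGx LGy muF SH dH α β : ℝ}

lemma norm_contraction_le (h : StepRegularity F G H H' ystar LH LF LGx LGy muF SH dH α β)
    (x : E) (y : E') : ‖x - H y - α • F x y‖ ≤ (1 - 7 / 8 * (muF * α)) * ‖x - H y‖ := by
  have hm := h.muF_mul_α_le
  have hα := h.α_pos
  refine (sq_le_sq₀ (norm_nonneg _) (mul_nonneg (by linarith) (norm_nonneg _))).1 ?_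
  have h1 := h.strong_mono x y
  have h2 : ‖F x y‖ ^ 2 ≤ (LF * ‖x - H y‖) ^ 2 := by gcongr; exact h.norm_F_le x y
  have h3 := mul_le_mul_of_nonneg_right h.α_mul_sq_le (mul_nonneg hα.le (sq_nonneg ‖x - H y‖))
  have h4 := mul_le_mul_of_nonneg_left h2 (sq_nonneg α)
  have h5 := mul_le_mul_of_nonneg_left h1 hα.le
  rw [norm_sub_sq_real, real_inner_smul_right, norm_smul, mul_pow, Real.norm_eq_abs, sq_abs]
  nlinarith [sq_nonneg (muF * α * ‖x - H y‖)]

lemma norm_drift_le (h : StepRegularity F G H H' ystar LH LF LGx LGy muF SH dH α β)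
    (x : E) (y : E') : ‖H y - H (y - β • G x y)‖ ≤
      muF * α / 200 * ‖x - H y‖ + LH * LGy * β * ‖y - ystar‖ := by
  have hβ := h.β_pos
  have hα := h.α_pos
  have hμ := h.muF_pos
  have hLH := h.LH_nonneg
  have hLGy := h.LGy_nonneg
  rcases h.coupling with hs | hc
  · rw [Subsingleton.elim (y - β • G x y) y, sub_self, norm_zero]
    positivity
  · calc ‖H y - H (y - β • G x y)‖ ≤ LH * ‖y - (y - β • G x y)‖ := h.lipschitz_H _ _
      _ = LH * (β * ‖G x y‖) := by rw [sub_sub_cancel, norm_smul, Real.norm_of_nonneg hβ.le]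
      _ ≤ LH * (β * (LGx * ‖x - H y‖ + LGy * ‖y - ystar‖)) := by gcongr; exact h.norm_G_le x y
      _ = LH * LGx * β * ‖x - H y‖ + LH * LGy * β * ‖y - ystar‖ := by ring
      _ ≤ _ := by gcongr

lemma norm_mean_step_le (h : StepRegularity F G H H' ystar LH LF LGx LGy muF SH dH α β)
    (x : E) (y : E') : ‖x - α • F x y - H (y - β • G x y)‖ ≤
      (1 - 87 / 100 * (muF * α)) * ‖x - H y‖ + LH * LGy * β * ‖y - ystar‖ := by
  have e : x - α • F x y - H (y - β • G x y)
      = (x - H y - α • F x y) + (H y - H (y - β • G x y)) := by abel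
  rw [e]
  have h1 := h.norm_contraction_le x y
  have h2 := h.norm_drift_le x y
  have h3 : 0 ≤ muF * α * ‖x - H y‖ :=
    mul_nonneg (mul_pos h.muF_pos h.α_pos).le (norm_nonneg _)
  exact (norm_add_le _ _).trans (by nlinarith)

lemma norm_fderiv_le (h : StepRegularity F G H H' ystar LH LF LGx LGy muF SH dH α β) (y : E') :
    ‖H' y‖ ≤ LH := by
  have hl : LipschitzWith LH.toNNReal H := LipschitzWith.of_dist_le_mul fun a b => by
    rw [dist_eq_norm, dist_eq_norm, Real.coe_toNNReal _ h.LH_nonneg]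
    exact h.lipschitz_H a b
  simpa [Real.coe_toNNReal _ h.LH_nonneg] using (h.hasFDerivAt_H y).le_of_lipschitz hl

lemma norm_fderiv_apply_le (h : StepRegularity F G H H' ystar LH LF LGx LGy muF SH dH α β)
    (v ψ : E') : ‖β • H' v ψ‖ ≤ LH * β * ‖ψ‖ := by
  rw [norm_smul, Real.norm_of_nonneg h.β_pos.le]
  calc β * ‖H' v ψ‖ ≤ β * (LH * ‖ψ‖) := mul_le_mul_of_nonneg_left
        ((H' v).le_of_opNorm_le (h.norm_fderiv_le v) ψ) h.β_pos.le
    _ = _ := by ring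

lemma norm_increment_le (h : StepRegularity F G H H' ystar LH LF LGx LGy muF SH dH α β)
    (v ψ : E') : ‖H v - H (v - β • ψ)‖ ≤ LH * β * ‖ψ‖ := by
  refine (h.lipschitz_H _ _).trans_eq ?_
  rw [sub_sub_cancel, norm_smul, Real.norm_of_nonneg h.β_pos.le, mul_assoc]

lemma norm_remainder_le (h : StepRegularity F G H H' ystar LH LF LGx LGy muF SH dH α β)
    (v ψ : E') : ‖H v - H (v - β • ψ) - β • H' v ψ‖ ≤ 2 * (LH * β * ‖ψ‖) :=
  (norm_sub_le _ _).trans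
    (by linarith [h.norm_increment_le v ψ, h.norm_fderiv_apply_le v ψ])

lemma sq_norm_remainder_le (h : StepRegularity F G H H' ystar LH LF LGx LGy muF SH dH α β)
    (v ψ : E') : ‖H v - H (v - β • ψ) - β • H' v ψ‖ ^ 2 ≤
      SH ^ 2 * β ^ (2 + 2 * dH) * (‖ψ‖ ^ 4) ^ ((1 + dH) / 2) := by
  have hβ := h.β_pos
  have e : H v - H (v - β • ψ) - β • H' v ψ
      = -(H (v - β • ψ) - H v - H' v (v - β • ψ - v)) := by
    rw [sub_sub_cancel_left, map_neg, map_smul]; abel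
  have h1 := h.taylor_H (v - β • ψ) v
  rw [sub_sub_cancel_left, norm_neg, norm_smul, Real.norm_of_nonneg hβ.le,
    Real.mul_rpow hβ.le (norm_nonneg _), ← sub_sub_cancel_left v (β • ψ), ← norm_neg, ← e] at h1
  refine (pow_le_pow_left₀ (norm_nonneg _) h1 2).trans_eq ?_
  have e1 : (β ^ (1 + dH)) ^ 2 = β ^ (2 + 2 * dH) := by
    rw [← Real.rpow_natCast, ← Real.rpow_mul hβ.le]; congr 1; push_cast; ring
  have e2 : (‖ψ‖ ^ (1 + dH)) ^ 2 = (‖ψ‖ ^ 4) ^ ((1 + dH) / 2) := by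
    rw [← Real.rpow_natCast, ← Real.rpow_natCast, ← Real.rpow_mul (norm_nonneg _),
      ← Real.rpow_mul (norm_nonneg _)]
    congr 1; push_cast; ring
  rw [mul_pow, mul_pow, e1, e2]; ring

end StepRegularity

namespace StepRegularity

variable {E E' : Type*} [NormedAddCommGroup E] [InnerProductSpace ℝ E]
    [NormedAddCommGroup E'] [InnerProductSpace ℝ E'] {F : E → E' → E} {G : E → E' → E'}
    {H : E' → E} {H' : E' → E' →L[ℝ] E} {ystar : E'} {LH LF LGx LGy muF SH dH α β : ℝ}

lemma norm_step_pow_four_le [CompleteSpace E] [CompleteSpace E']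
    (h : StepRegularity F G H H' ystar LH LF LGx LGy muF SH dH α β)
    {x ξ u : E} {y ψ v : E'} {X q : ℝ} (hX : X = ‖x - H y‖) (hq : q = LH * LGy * β * ‖y - ystar‖)
    (hv : v = y - β • G x y) (hu : u = x - α • F x y - H v) :
    ‖x - α • (F x y + ξ) - H (y - β • (G x y + ψ))‖ ^ 4 ≤
      ((1 - muF * α) * X ^ 4 + 24 * q * X ^ 3 + 40 * q ^ 2 * X ^ 2 + 1280 * q ^ 4) +
        X ^ 2 * (20 * (α * ‖ξ‖) ^ 2 + 20 * (LH * β * ‖ψ‖) ^ 2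
          + 64 / (muF * α) * ‖H v - H (v - β • ψ) - β • H' v ψ‖ ^ 2) +
        (32 * (α * ‖ξ‖) ^ 4 + 224 * (LH * β * ‖ψ‖) ^ 4) +
        ⟪-(4 * α * ‖u‖ ^ 2) • u, ξ⟫ +
        ⟪(4 * β * ‖u‖ ^ 2) • ContinuousLinearMap.adjoint (H' v) u, ψ⟫ := by
  have hα := h.α_pos
  have hβ := h.β_pos
  have hLH := h.LH_nonneg
  have hLGy := h.LGy_nonneg
  set M : E := -(α • ξ) + β • H' v ψ with hM
  set R : E := H v - H (v - β • ψ) - β • H' v ψ with hR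
  have hMR : M + R = -(α • ξ) + (H v - H (v - β • ψ)) := by rw [hM, hR]; abel
  have hstep : x - α • (F x y + ξ) - H (y - β • (G x y + ψ)) = u + (M + R) := by
    rw [hMR, hu, smul_add, smul_add, ← sub_sub y, ← hv]; abel
  have hn : ‖M + R‖ ≤ α * ‖ξ‖ + LH * β * ‖ψ‖ := by
    rw [hMR]
    refine (norm_add_le _ _).trans (add_le_add ?_ (h.norm_increment_le v ψ))
    rw [norm_neg, norm_smul, Real.norm_of_nonneg hα.le]
  have hU : ‖u‖ ≤ (1 - 87 / 100 * (muF * α)) * X + q := by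
    rw [hu, hv, hX, hq]; exact h.norm_mean_step_le x y
  have hpoly := poly_bound (mul_pos h.muF_pos hα) h.muF_mul_α_le (hX ▸ norm_nonneg _)
    (by rw [hq]; positivity) (norm_nonneg u) (by positivity : 0 ≤ α * ‖ξ‖)
    (by positivity : 0 ≤ LH * β * ‖ψ‖) (norm_nonneg R) (norm_nonneg (M + R))
    (h.norm_remainder_le v ψ) hn hU
  have hin : ⟪-(4 * α * ‖u‖ ^ 2) • u, ξ⟫ +
      ⟪(4 * β * ‖u‖ ^ 2) • ContinuousLinearMap.adjoint (H' v) u, ψ⟫ = 4 * ‖u‖ ^ 2 * ⟪u, M⟫ := by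
    rw [hM, inner_add_right, inner_neg_right, real_inner_smul_left, real_inner_smul_left,
      real_inner_smul_right, real_inner_smul_right, ContinuousLinearMap.adjoint_inner_left]
    ring
  rw [hstep]
  linarith [norm_add_pow_four_le u M R]

end StepRegularity

lemma condExp_linear_combination_le {Ω : Type*} {m mΩ : MeasurableSpace Ω} {μ : Measure Ω}
    {f g : Ω → ℝ} (hf : Integrable f μ) (hg : Integrable g μ) {a b A B : ℝ} (ha : 0 ≤ a)
    (hb : 0 ≤ b) (hA : ∀ᵐ ω ∂μ, (μ[f | m]) ω ≤ A) (hB : ∀ᵐ ω ∂μ, (μ[g | m]) ω ≤ B) :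
    ∀ᵐ ω ∂μ, (μ[fun ω => a * f ω + b * g ω | m]) ω ≤ a * A + b * B := by
  filter_upwards [condExp_add (hf.const_mul a) (hg.const_mul b) m, condExp_smul a f m,
    condExp_smul b g m, hA, hB] with ω h1 h2 h3 h4 h5
  have h2' : (μ[fun ω => a * f ω | m]) ω = a * (μ[f | m]) ω := h2
  have h3' : (μ[fun ω => b * g ω | m]) ω = b * (μ[g | m]) ω := h3
  refine h1.trans_le ?_
  rw [Pi.add_apply, h2', h3']
  gcongr

lemma measurable_adjoint_apply {E E' : Type*} [NormedAddCommGroup E] [InnerProductSpace ℝ E]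
    [FiniteDimensional ℝ E] [MeasurableSpace E] [BorelSpace E]
    [NormedAddCommGroup E'] [InnerProductSpace ℝ E'] [FiniteDimensional ℝ E'] [MeasurableSpace E']
    [CompleteSpace E] [CompleteSpace E'] [BorelSpace E'] {Ω : Type*} [MeasurableSpace Ω]
    {T : Ω → E' →L[ℝ] E} {u : Ω → E} (hT : Measurable T) (hu : Measurable u) :
    Measurable fun ω => ContinuousLinearMap.adjoint (T ω) (u ω) := by
  have := FiniteDimensional.proper ℝ E
  have hc : Continuous fun T : E' →L[ℝ] E => ContinuousLinearMap.adjoint T :=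
    LinearIsometryEquiv.continuous _
  have hc' : Continuous fun p : (E' →L[ℝ] E) × E => ContinuousLinearMap.adjoint p.1 p.2 :=
    (hc.comp continuous_fst).clm_apply continuous_snd
  have := FiniteDimensional.proper ℝ (E' →L[ℝ] E)
  exact (hc'.comp_stronglyMeasurable (hT.stronglyMeasurable.prodMk hu.stronglyMeasurable)).measurable

namespace StepRegularity

variable {E E' : Type*} [NormedAddCommGroup E] [InnerProductSpace ℝ E]
    [NormedAddCommGroup E'] [InnerProductSpace ℝ E'] {F : E → E' → E} {G : E → E' → E'}
    {H : E' → E} {H' : E' → E' →L[ℝ] E} {ystar : E'} {LH LF LGx LGy muF SH dH α β : ℝ}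

lemma continuous_H (h : StepRegularity F G H H' ystar LH LF LGx LGy muF SH dH α β) :
    Continuous H :=
  continuous_iff_continuousAt.2 fun y => (h.hasFDerivAt_H y).continuousAt

lemma measurable_fderiv_H [FiniteDimensional ℝ E] [FiniteDimensional ℝ E']
    [MeasurableSpace E'] [BorelSpace E']
    (h : StepRegularity F G H H' ystar LH LF LGx LGy muF SH dH α β) : Measurable H' := by
  have := FiniteDimensional.complete ℝ E
  have := FiniteDimensional.proper ℝ E'
  rw [← funext fun y => (h.hasFDerivAt_H y).fderiv]
  exact measurable_fderiv ℝ H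

lemma memLp_H_comp {Ω : Type*} {mΩ : MeasurableSpace Ω} {μ : Measure Ω} [IsFiniteMeasure μ]
    {y : Ω → E'} (h : StepRegularity F G H H' ystar LH LF LGx LGy muF SH dH α β)
    (hy : MemLp y 4 μ) : MemLp (fun ω => H (y ω)) 4 μ := by
  have h1 : MemLp (fun ω => y ω - ystar) 4 μ := hy.sub (memLp_const ystar)
  have h2 : MemLp (fun ω => H (y ω) - H ystar) 4 μ :=
    h1.of_le_mul (c := LH)
      ((h.continuous_H.comp_aestronglyMeasurable hy.1).sub aestronglyMeasurable_const)
      (ae_of_all _ fun ω => h.lipschitz_H _ _)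
  have h3 := h2.add (memLp_const (H ystar))
  rwa [show ((fun ω => H (y ω) - H ystar) + fun _ => H ystar) = fun ω => H (y ω) from
    funext fun ω => sub_add_cancel _ _] at h3

variable [FiniteDimensional ℝ E] [FiniteDimensional ℝ E'] [MeasurableSpace E] [BorelSpace E]
  [MeasurableSpace E'] [BorelSpace E'] {Ω : Type*}

lemma memLp_step {mΩ : MeasurableSpace Ω} {μ : Measure Ω} [IsFiniteMeasure μ]
    {x ξ : Ω → E} {y ψ : Ω → E'}
    (h : StepRegularity F G H H' ystar LH LF LGx LGy muF SH dH α β)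
    (hF : Measurable fun p : E × E' => F p.1 p.2) (hG : Measurable fun p : E × E' => G p.1 p.2)
    (hxm : Measurable x) (hym : Measurable y)
    (hx : MemLp x 4 μ) (hy : MemLp y 4 μ) (hξ : MemLp ξ 4 μ) (hψ : MemLp ψ 4 μ) :
    MemLp (fun ω => x ω - α • (F (x ω) (y ω) + ξ ω)) 4 μ ∧
      MemLp (fun ω => y ω - β • (G (x ω) (y ω) + ψ ω)) 4 μ := by
  have hX : MemLp (fun ω => x ω - H (y ω)) 4 μ := hx.sub (h.memLp_H_comp hy)
  have hY : MemLp (fun ω => y ω - ystar) 4 μ := hy.sub (memLp_const ystar)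
  have hF4 : MemLp (fun ω => F (x ω) (y ω)) 4 μ :=
    hX.of_le_mul (c := LF) (hF.comp (hxm.prodMk hym)).aestronglyMeasurable
      (ae_of_all _ fun ω => h.norm_F_le _ _)
  have hG4 : MemLp (fun ω => G (x ω) (y ω)) 4 μ := by
    refine ((hX.norm.const_mul LGx).add (hY.norm.const_mul LGy)).of_le
      (hG.comp (hxm.prodMk hym)).aestronglyMeasurable (ae_of_all _ fun ω => ?_)
    exact (h.norm_G_le _ _).trans (le_abs_self _)
  exact ⟨hx.sub ((hF4.add hξ).const_smul α), hy.sub ((hG4.add hψ).const_smul β)⟩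

lemma condExp_norm_pow_four_le {m mΩ : MeasurableSpace Ω} {μ : Measure Ω} [IsFiniteMeasure μ]
    {x ξ : Ω → E} {y ψ : Ω → E'}
    (h : StepRegularity F G H H' ystar LH LF LGx LGy muF SH dH α β) (hm : m ≤ mΩ)
    (hF : Measurable fun p : E × E' => F p.1 p.2) (hG : Measurable fun p : E × E' => G p.1 p.2)
    (hxy : Measurable[m] fun ω => (x ω, y ω))
    (hx : MemLp x 4 μ) (hy : MemLp y 4 μ) (hξ : MemLp ξ 4 μ) (hψ : MemLp ψ 4 μ)
    {Γ11 Γ22 : ℝ} (hΓ11 : 0 ≤ Γ11) (hΓ22 : 0 ≤ Γ22)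
    (hξ0 : μ[ξ | m] =ᵐ[μ] 0) (hψ0 : μ[ψ | m] =ᵐ[μ] 0)
    (hξ4 : ∀ᵐ ω ∂μ, (μ[fun ω => ‖ξ ω‖ ^ 4 | m]) ω ≤ Γ11 ^ 2)
    (hψ4 : ∀ᵐ ω ∂μ, (μ[fun ω => ‖ψ ω‖ ^ 4 | m]) ω ≤ Γ22 ^ 2) :
    ∀ᵐ ω ∂μ, (μ[fun ω => ‖x ω - α • (F (x ω) (y ω) + ξ ω) -
        H (y ω - β • (G (x ω) (y ω) + ψ ω))‖ ^ 4 | m]) ω ≤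
      ((1 - muF * α) * ‖x ω - H (y ω)‖ ^ 4
        + 24 * (LH * LGy * β * ‖y ω - ystar‖) * ‖x ω - H (y ω)‖ ^ 3
        + 40 * (LH * LGy * β * ‖y ω - ystar‖) ^ 2 * ‖x ω - H (y ω)‖ ^ 2
        + 1280 * (LH * LGy * β * ‖y ω - ystar‖) ^ 4) +
      ‖x ω - H (y ω)‖ ^ 2 * (20 * α ^ 2 * Γ11 + 1 * (20 * (LH * β) ^ 2 * Γ22
        + 64 / (muF * α) * (SH ^ 2 * β ^ (2 + 2 * dH)) * Γ22 ^ (1 + dH))) +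
      (32 * α ^ 4 * Γ11 ^ 2 + 224 * (LH * β) ^ 4 * Γ22 ^ 2) := by
  have := FiniteDimensional.complete ℝ E
  have := FiniteDimensional.complete ℝ E'
  have := FiniteDimensional.proper ℝ E
  have := FiniteDimensional.proper ℝ E'
  have hα := h.α_pos
  have hβ := h.β_pos
  have hμF := h.muF_pos
  have hHm : Measurable H := h.continuous_H.measurable
  have hxy' : Measurable fun ω => (x ω, y ω) := hxy.mono hm le_rfl
  have hxm : Measurable x := hxy'.fst
  have hym : Measurable y := hxy'.snd
  -- the drift quantities as measurable functions of the state
  let v : E × E' → E' := fun p => p.2 - β • G p.1 p.2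
  let u : E × E' → E := fun p => p.1 - α • F p.1 p.2 - H (v p)
  have hvm : Measurable v := measurable_snd.sub (hG.const_smul β)
  have hum : Measurable u := (measurable_fst.sub (hF.const_smul α)).sub (hHm.comp hvm)
  have hXm : Measurable fun p : E × E' => ‖p.1 - H p.2‖ := by fun_prop
  have hqm : Measurable fun p : E × E' => LH * LGy * β * ‖p.2 - ystar‖ := by fun_prop
  have hadj : Measurable fun p => ContinuousLinearMap.adjoint (H' (v p)) (u p) :=
    measurable_adjoint_apply (h.measurable_fderiv_H.comp hvm) hum
  -- fourth moments
  have hsteps := h.memLp_step hF hG hxm hym hx hy hξ hψ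
  have hmean := h.memLp_step hF hG hxm hym hx hy (MemLp.zero (ε := E)) (MemLp.zero (ε := E'))
  simp only [Pi.zero_apply, add_zero] at hmean
  have hX : MemLp (fun ω => ‖x ω - H (y ω)‖) 4 μ := (hx.sub (h.memLp_H_comp hy)).norm
  have hq : MemLp (fun ω => LH * LGy * β * ‖y ω - ystar‖) 4 μ :=
    (hy.sub (memLp_const ystar)).norm.const_mul _
  have hU : MemLp (fun ω => ‖u (x ω, y ω)‖) 4 μ := (hmean.1.sub (h.memLp_H_comp hmean.2)).norm
  have iξ := (memLp_four_iff hξ.1).1 hξ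
  have iψ := (memLp_four_iff hψ.1).1 hψ
  have hone : MemLp (fun _ : Ω => (1 : ℝ)) 4 μ := memLp_const 1
  -- conditional moments of the noise
  have hdH := h.dH_mem
  obtain ⟨iξ2, hξ2⟩ := condExp_rpow_le hm iξ (fun ω => by positivity) (s := 1 / 2)
    (by norm_num) (by norm_num) hξ4
  obtain ⟨iψ2, hψ2⟩ := condExp_rpow_le hm iψ (fun ω => by positivity) (s := 1 / 2)
    (by norm_num) (by norm_num) hψ4
  obtain ⟨iψd, hψd⟩ := condExp_rpow_le hm iψ (fun ω => by positivity) (s := (1 + dH) / 2)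
    (by linarith [hdH.1]) (by linarith [hdH.2]) hψ4
  have hsqrt : ∀ a : ℝ, 0 ≤ a → (a ^ 2) ^ (1 / 2 : ℝ) = a := fun a ha => by
    rw [← Real.sqrt_eq_rpow, Real.sqrt_sq ha]
  have hsqrt4 : ∀ a : ℝ, (a ^ 4) ^ (1 / 2 : ℝ) = a ^ 2 := fun a => by
    rw [← hsqrt (a ^ 2) (sq_nonneg a), ← pow_mul]
  have hΓd : (Γ22 ^ 2) ^ ((1 + dH) / 2) = Γ22 ^ (1 + dH) := by
    rw [← Real.rpow_natCast, ← Real.rpow_mul hΓ22]; congr 1; push_cast; ring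
  rw [hsqrt _ hΓ11] at hξ2
  rw [hsqrt _ hΓ22] at hψ2
  rw [hΓd] at hψd
  simp only [hsqrt4] at iξ2 hξ2 iψ2 hψ2
  have hs := condExp_linear_combination_le iξ2
    ((iψ2.const_mul (20 * (LH * β) ^ 2)).add
      (iψd.const_mul (64 / (muF * α) * (SH ^ 2 * β ^ (2 + 2 * dH)))))
    (by positivity : 0 ≤ 20 * α ^ 2) zero_le_one hξ2
    (condExp_linear_combination_le iψ2 iψd (by positivity) (by positivity) hψ2 hψd)
  have hv := condExp_linear_combination_le iξ iψ (by positivity : 0 ≤ 32 * α ^ 4)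
    (by positivity : 0 ≤ 224 * (LH * β) ^ 4) hξ4 hψ4
  -- the linearization error of `H` along the noise
  let R : Ω → E := fun ω =>
    H (v (x ω, y ω)) - H (v (x ω, y ω) - β • ψ ω) - β • H' (v (x ω, y ω)) (ψ ω)
  have hR : AEStronglyMeasurable R μ := by
    have hvxy : Measurable fun ω => v (x ω, y ω) := hvm.comp hxy'
    refine ((hHm.comp hvxy).aestronglyMeasurable.sub (h.continuous_H.comp_aestronglyMeasurable
      (hvxy.aestronglyMeasurable.sub (hψ.1.const_smul β)))).sub (AEStronglyMeasurable.const_smul ?_ β)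
    have hcl : Continuous fun p : (E' →L[ℝ] E) × E' => p.1 p.2 :=
      continuous_fst.clm_apply continuous_snd
    have := FiniteDimensional.proper ℝ (E' →L[ℝ] E)
    exact hcl.comp_aestronglyMeasurable
      ((h.measurable_fderiv_H.comp hvxy).aestronglyMeasurable.prodMk hψ.1)
  have hR4 : MemLp R 4 μ := hψ.of_le_mul (c := 2 * (LH * β)) hR (ae_of_all _ fun ω =>
    (h.norm_remainder_le (v (x ω, y ω)) (ψ ω)).trans_eq (by ring))
  have iXsq : ∀ {f : Ω → ℝ}, MemLp f 4 μ → Integrable (fun ω => ‖x ω - H (y ω)‖ ^ 2 * f ω ^ 2) μ :=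
    fun hf => (hX.integrable_mul_four hX hf hf).congr (ae_of_all _ fun ω => by ring)
  have isq : ∀ {f : Ω → ℝ}, MemLp f 4 μ → Integrable (fun ω => f ω ^ 2) μ :=
    fun hf => (hone.integrable_mul_four hone hf hf).congr (ae_of_all _ fun ω => by ring)
  have hαξ : MemLp (fun ω => α * ‖ξ ω‖) 4 μ := hξ.norm.const_mul α
  have hβψ : MemLp (fun ω => LH * β * ‖ψ ω‖) 4 μ := hψ.norm.const_mul _
  refine condExp_le_of_le_add_inner hm
    (K := fun ω => (1 - muF * α) * ‖x ω - H (y ω)‖ ^ 4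
        + 24 * (LH * LGy * β * ‖y ω - ystar‖) * ‖x ω - H (y ω)‖ ^ 3
        + 40 * (LH * LGy * β * ‖y ω - ystar‖) ^ 2 * ‖x ω - H (y ω)‖ ^ 2
        + 1280 * (LH * LGy * β * ‖y ω - ystar‖) ^ 4)
    (P := fun ω => ‖x ω - H (y ω)‖ ^ 2)
    (S := fun ω => 20 * (α * ‖ξ ω‖) ^ 2 + 20 * (LH * β * ‖ψ ω‖) ^ 2
      + 64 / (muF * α) * ‖R ω‖ ^ 2)
    (V := fun ω => 32 * α ^ 4 * ‖ξ ω‖ ^ 4 + 224 * (LH * β) ^ 4 * ‖ψ ω‖ ^ 4)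
    (w := fun ω => -(4 * α * ‖u (x ω, y ω)‖ ^ 2) • u (x ω, y ω))
    (w' := fun ω => (4 * β * ‖u (x ω, y ω)‖ ^ 2) •
      ContinuousLinearMap.adjoint (H' (v (x ω, y ω))) (u (x ω, y ω)))
    ?_ ?_ ?_ (fun ω => by positivity) ?_ ?_ ?_ ?_ ?_ ?_ hs hv ?_ (hξ.integrable (by norm_num)) ?_ hξ0
    ?_ (hψ.integrable (by norm_num)) ?_ hψ0 ?_
  · exact (memLp_four_iff (hsteps.1.sub (h.memLp_H_comp hsteps.2)).1).1
      (hsteps.1.sub (h.memLp_H_comp hsteps.2))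
  · have i1 := (hX.integrable_mul_four hX hX hX).const_mul (1 - muF * α)
    have i2 := (hq.integrable_mul_four hX hX hX).const_mul 24
    have i3 := (hq.integrable_mul_four hq hX hX).const_mul 40
    have i4 := (hq.integrable_mul_four hq hq hq).const_mul 1280
    refine (((i1.add i2).add i3).add i4).congr (ae_of_all _ fun ω => ?_)
    simp only [Pi.add_apply]
    ring
  · exact ((((hXm.pow_const 4).const_mul _).add ((hqm.const_mul 24).mul (hXm.pow_const 3))).add
      (((hqm.pow_const 2).const_mul 40).mul (hXm.pow_const 2))).add
      ((hqm.pow_const 4).const_mul 1280) |>.comp hxy |>.stronglyMeasurable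
  · exact ((hXm.pow_const 2).comp hxy).stronglyMeasurable
  · refine ((((iXsq hαξ).const_mul 20).add ((iXsq hβψ).const_mul 20)).add
      ((iXsq hR4.norm).const_mul (64 / (muF * α)))).congr (ae_of_all _ fun ω => ?_)
    simp only [Pi.add_apply]
    ring
  · exact (((isq hαξ).const_mul 20).add ((isq hβψ).const_mul 20)).add
      ((isq hR4.norm).const_mul (64 / (muF * α)))
  · exact (iξ2.const_mul _).add (((iψ2.const_mul (20 * (LH * β) ^ 2)).add
      (iψd.const_mul (64 / (muF * α) * (SH ^ 2 * β ^ (2 + 2 * dH))))).const_mul 1)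
  · exact (iξ.const_mul _).add (iψ.const_mul _)
  · intro ω
    have h1 := mul_le_mul_of_nonneg_left (h.sq_norm_remainder_le (v (x ω, y ω)) (ψ ω))
      (by positivity : 0 ≤ 64 / (muF * α))
    simp only [Pi.add_apply, R]
    linarith
  · exact (((hum.norm.pow_const 2).const_mul (4 * α)).neg.smul hum).comp hxy |>.stronglyMeasurable
  · refine ((hU.integrable_mul_four hU hU hξ.norm).const_mul (4 * α)).mono'
      (((((hum.norm.pow_const 2).const_mul (4 * α)).neg.smul hum).comp hxy').aestronglyMeasurable.inner
        hξ.1) (ae_of_all _ fun ω => (norm_inner_le_norm _ _).trans_eq ?_)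
    rw [norm_smul, norm_neg, Real.norm_of_nonneg (by positivity)]
    ring
  · exact (((hum.norm.pow_const 2).const_mul (4 * β)).smul hadj).comp hxy |>.stronglyMeasurable
  · refine ((hU.integrable_mul_four hU hU hψ.norm).const_mul (4 * β * LH)).mono'
      (((((hum.norm.pow_const 2).const_mul (4 * β)).smul hadj).comp hxy').aestronglyMeasurable.inner
        hψ.1) (ae_of_all _ fun ω => (norm_inner_le_norm _ _).trans ?_)
    rw [norm_smul, Real.norm_of_nonneg (by positivity)]
    have h1 : ‖ContinuousLinearMap.adjoint (H' (v (x ω, y ω))) (u (x ω, y ω))‖ ≤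
        LH * ‖u (x ω, y ω)‖ :=
      ContinuousLinearMap.le_of_opNorm_le _ ((LinearIsometryEquiv.norm_map _ _).trans_le
        (h.norm_fderiv_le _)) _
    calc 4 * β * ‖u (x ω, y ω)‖ ^ 2 *
          ‖ContinuousLinearMap.adjoint (H' (v (x ω, y ω))) (u (x ω, y ω))‖ * ‖ψ ω‖
        ≤ 4 * β * ‖u (x ω, y ω)‖ ^ 2 * (LH * ‖u (x ω, y ω)‖) * ‖ψ ω‖ := by gcongr
      _ = _ := by ring
  · intro ω
    refine (h.norm_step_pow_four_le (ξ := ξ ω) (ψ := ψ ω) (x := x ω) (y := y ω)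
      rfl rfl rfl rfl).trans_eq ?_
    simp only [R, u, v]
    ring

end StepRegularity

section natFilt

variable {Ω : Type} [mΩ : MeasurableSpace Ω] {dx dy : ℕ}
  {x0 : Ω → EuclideanSpace ℝ (Fin dx)} {y0 : Ω → EuclideanSpace ℝ (Fin dy)}
  {ξ : ℕ → Ω → EuclideanSpace ℝ (Fin dx)} {ψ : ℕ → Ω → EuclideanSpace ℝ (Fin dy)}

lemma natFilt_le (hx0 : Measurable x0) (hy0 : Measurable y0) (hξ : ∀ t, Measurable (ξ t))
    (hψ : ∀ t, Measurable (ψ t)) (t : ℕ) : natFilt x0 y0 ξ ψ t ≤ mΩ :=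
  sup_le (sup_le hx0.comap_le hy0.comap_le)
    (iSup₂_le fun s _ => sup_le (hξ s).comap_le (hψ s).comap_le)

lemma natFilt_le_succ (t : ℕ) : natFilt x0 y0 ξ ψ t ≤ natFilt x0 y0 ξ ψ (t + 1) :=
  sup_le_sup le_rfl (biSup_mono fun _ hs =>
    Finset.mem_range.2 ((Finset.mem_range.1 hs).trans t.lt_succ_self))

lemma comap_noise_le_natFilt_succ (t : ℕ) :
    MeasurableSpace.comap (ξ t) inferInstance ⊔ MeasurableSpace.comap (ψ t) inferInstance ≤
      natFilt x0 y0 ξ ψ (t + 1) :=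
  le_trans (le_iSup₂_of_le (f := fun s (_ : s ∈ Finset.range (t + 1)) =>
      MeasurableSpace.comap (ξ s) inferInstance ⊔ MeasurableSpace.comap (ψ s) inferInstance)
      t (Finset.self_mem_range_succ t) le_rfl) le_sup_right

lemma measurable_natFilt_iterates {F : EuclideanSpace ℝ (Fin dx) → EuclideanSpace ℝ (Fin dy) →
      EuclideanSpace ℝ (Fin dx)}
    {G : EuclideanSpace ℝ (Fin dx) → EuclideanSpace ℝ (Fin dy) → EuclideanSpace ℝ (Fin dy)}
    {alpha beta : ℕ → ℝ} {x : ℕ → Ω → EuclideanSpace ℝ (Fin dx)}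
    {y : ℕ → Ω → EuclideanSpace ℝ (Fin dy)}
    (hxupd : ∀ t ω, x (t + 1) ω = x t ω - alpha t • (F (x t ω) (y t ω) + ξ t ω))
    (hyupd : ∀ t ω, y (t + 1) ω = y t ω - beta t • (G (x t ω) (y t ω) + ψ t ω))
    (hF : Measurable fun p : EuclideanSpace ℝ (Fin dx) × EuclideanSpace ℝ (Fin dy) => F p.1 p.2)
    (hG : Measurable fun p : EuclideanSpace ℝ (Fin dx) × EuclideanSpace ℝ (Fin dy) => G p.1 p.2)
    (t : ℕ) : Measurable[natFilt (x 0) (y 0) ξ ψ t] fun ω => (x t ω, y t ω) := by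
  induction t with
  | zero =>
    have h1 : Measurable[natFilt (x 0) (y 0) ξ ψ 0] (x 0) :=
      measurable_iff_comap_le.2 (le_sup_left.trans le_sup_left)
    have h2 : Measurable[natFilt (x 0) (y 0) ξ ψ 0] (y 0) :=
      measurable_iff_comap_le.2 (le_sup_right.trans le_sup_left)
    exact h1.prodMk h2
  | succ t ih =>
    have h := ih.mono (natFilt_le_succ t) le_rfl
    have hξ : Measurable[natFilt (x 0) (y 0) ξ ψ (t + 1)] (ξ t) :=
      measurable_iff_comap_le.2 (le_sup_left.trans (comap_noise_le_natFilt_succ t))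
    have hψ : Measurable[natFilt (x 0) (y 0) ξ ψ (t + 1)] (ψ t) :=
      measurable_iff_comap_le.2 (le_sup_right.trans (comap_noise_le_natFilt_succ t))
    rw [show (fun ω => (x (t + 1) ω, y (t + 1) ω)) = fun ω =>
        (x t ω - alpha t • (F (x t ω) (y t ω) + ξ t ω),
          y t ω - beta t • (G (x t ω) (y t ω) + ψ t ω)) from
      funext fun ω => by rw [hxupd, hyupd]]
    exact (h.fst.sub (((hF.comp h).add hξ).const_smul (alpha t))).prodMk
      (h.snd.sub (((hG.comp h).add hψ).const_smul (beta t)))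

end natFilt

/-- Lemma 3.6 (one-step descent of the fourth-order moment of the fast iterate). -/
theorem fourth_moment_descent_fast
    {Ω : Type} [MeasurableSpace Ω] (μ : Measure Ω) [IsProbabilityMeasure μ]
    {dx dy : ℕ}
    (F : EuclideanSpace ℝ (Fin dx) → EuclideanSpace ℝ (Fin dy) → EuclideanSpace ℝ (Fin dx))
    (G : EuclideanSpace ℝ (Fin dx) → EuclideanSpace ℝ (Fin dy) → EuclideanSpace ℝ (Fin dy))
    (H : EuclideanSpace ℝ (Fin dy) → EuclideanSpace ℝ (Fin dx))
    (xstar : EuclideanSpace ℝ (Fin dx)) (ystar : EuclideanSpace ℝ (Fin dy))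
    (hFroot : F xstar ystar = 0) (hGroot : G xstar ystar = 0)
    -- Assumption 1
    (LH LF : ℝ) (hLH : 0 ≤ LH) (hLF : 0 ≤ LF)
    (hFH : ∀ y, F (H y) y = 0)
    (hFHuniq : ∀ y x', F x' y = 0 → x' = H y)
    (hHlip : ∀ y₁ y₂, ‖H y₁ - H y₂‖ ≤ LH * ‖y₁ - y₂‖)
    (hFlip : ∀ x' y, ‖F x' y - F (H y) y‖ ≤ LF * ‖x' - H y‖)
    -- Assumption 2
    (LGx LGy : ℝ) (hLGx : 0 ≤ LGx) (hLGy : 0 ≤ LGy)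
    (hGlipx : ∀ x' y, ‖G x' y - G (H y) y‖ ≤ LGx * ‖x' - H y‖)
    (hGlipy : ∀ y, ‖G (H y) y - G (H ystar) ystar‖ ≤ LGy * ‖y - ystar‖)
    -- Assumption 3
    (muF muG : ℝ) (hmuF : 0 < muF) (hmuG : 0 < muG)
    (hFmono : ∀ x' y, muF * ‖x' - H y‖ ^ 2 ≤ ⟪x' - H y, F x' y - F (H y) y⟫)
    (hGmono : ∀ y, muG * ‖y - ystar‖ ^ 2 ≤ ⟪y - ystar, G (H y) y - G (H ystar) ystar⟫)
    -- Assumption 4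
    (H' : EuclideanSpace ℝ (Fin dy) → (EuclideanSpace ℝ (Fin dy) →L[ℝ] EuclideanSpace ℝ (Fin dx)))
    (hH' : ∀ y, HasFDerivAt H (H' y) y)
    (SH dH : ℝ) (hSH : 0 ≤ SH) (hdH : dH ∈ Set.Icc (0 : ℝ) 1)
    (hHtaylor : ∀ y₁ y₂, ‖H y₁ - H y₂ - H' y₂ (y₁ - y₂)‖ ≤ SH * ‖y₁ - y₂‖ ^ (1 + dH))
    -- the two-time-scale stochastic approximation process
    (alpha beta : ℕ → ℝ) (halpha : ∀ t, 0 < alpha t) (hbeta : ∀ t, 0 < beta t)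
    (ξ : ℕ → Ω → EuclideanSpace ℝ (Fin dx)) (ψ : ℕ → Ω → EuclideanSpace ℝ (Fin dy))
    (x : ℕ → Ω → EuclideanSpace ℝ (Fin dx)) (y : ℕ → Ω → EuclideanSpace ℝ (Fin dy))
    (hxupd : ∀ t ω, x (t + 1) ω = x t ω - alpha t • (F (x t ω) (y t ω) + ξ t ω))
    (hyupd : ∀ t ω, y (t + 1) ω = y t ω - beta t • (G (x t ω) (y t ω) + ψ t ω))
    -- measurability
    (hFmeas : Measurable fun p : EuclideanSpace ℝ (Fin dx) × EuclideanSpace ℝ (Fin dy) => F p.1 p.2)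
    (hGmeas : Measurable fun p : EuclideanSpace ℝ (Fin dx) × EuclideanSpace ℝ (Fin dy) => G p.1 p.2)
    (hx0meas : Measurable (x 0)) (hy0meas : Measurable (y 0))
    (hξmeas : ∀ t, Measurable (ξ t)) (hψmeas : ∀ t, Measurable (ψ t))
    -- finite initial fourth moments
    (hx0L4 : Integrable (fun ω => ‖x 0 ω‖ ^ 4) μ) (hy0L4 : Integrable (fun ω => ‖y 0 ω‖ ^ 4) μ)
    -- noise assumption (Assumption 6)
    (Γ11 Γ22 Sig11 Sig22 Sig12 : ℝ) (hΓ11 : 0 ≤ Γ11) (hΓ22 : 0 ≤ Γ22)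
    (hξmean : ∀ t, μ[ξ t | natFilt (x 0) (y 0) ξ ψ t] =ᵐ[μ] 0)
    (hψmean : ∀ t, μ[ψ t | natFilt (x 0) (y 0) ξ ψ t] =ᵐ[μ] 0)
    (hξ4int : ∀ t, Integrable (fun ω => ‖ξ t ω‖ ^ 4) μ)
    (hψ4int : ∀ t, Integrable (fun ω => ‖ψ t ω‖ ^ 4) μ)
    (hξ4 : ∀ t, ∀ᵐ ω ∂μ, (μ[fun ω' => ‖ξ t ω'‖ ^ 4 | natFilt (x 0) (y 0) ξ ψ t]) ω ≤ Γ11 ^ 2)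
    (hψ4 : ∀ t, ∀ᵐ ω ∂μ, (μ[fun ω' => ‖ψ t ω'‖ ^ 4 | natFilt (x 0) (y 0) ξ ψ t]) ω ≤ Γ22 ^ 2)
    (hξξ : ∀ t, ∀ᵐ ω ∂μ, specNorm (Matrix.of fun i j =>
      (μ[fun ω' => ξ t ω' i * ξ t ω' j | natFilt (x 0) (y 0) ξ ψ t]) ω) ≤ Sig11)
    (hψψ : ∀ t, ∀ᵐ ω ∂μ, specNorm (Matrix.of fun i j =>
      (μ[fun ω' => ψ t ω' i * ψ t ω' j | natFilt (x 0) (y 0) ξ ψ t]) ω) ≤ Sig22)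
    (hξψ : ∀ t, ∀ᵐ ω ∂μ, specNorm (Matrix.of fun i j =>
      (μ[fun ω' => ξ t ω' i * ψ t ω' j | natFilt (x 0) (y 0) ξ ψ t]) ω) ≤ Sig12)
    (dF dG : ℝ)
    -- Assumption 7 (step sizes)
    (hαub : ∀ t, alpha t ≤ min (muF / (4 * LF ^ 2)) (1 / (12 * muF)))
    (hβub : ∀ t, beta t ≤ min (muG / LGx ^ 2) (1 / (14 * muG)))
    (hκub : ∀ t, beta t / alpha t ≤
      min (muF * muG / (max (28 * (dx : ℝ)) (200 * LGy) * LH * LGx)) (muF / (5 * muG)))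
    (hρub : ∀ t, beta t ^ 2 / alpha t ≤ muF / (max (16 * (dx : ℝ)) 200 * LH ^ 2 * LGx ^ 2))
    (hαgrow : ∀ t, alpha (t + 1) ≤ alpha t ∧ alpha t / alpha (t + 1) ≤
      1 + min (dF * muF * alpha (t + 1) / 16)
        (min (dF * muG * beta (t + 1) / 16) (dG * muG * beta (t + 1) / 8)))
    (hβgrow : ∀ t, beta (t + 1) ≤ beta t ∧ beta t / beta (t + 1) ≤ 1 + muG * beta (t + 1) / 64)
    (hratio : ∀ t, beta (t + 1) / alpha (t + 1) ≤ beta t / alpha t)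
 :
    ∀ t : ℕ, ∀ᵐ ω ∂μ,
      (μ[fun ω' => ‖x (t + 1) ω' - H (y (t + 1) ω')‖ ^ 4 | natFilt (x 0) (y 0) ξ ψ t]) ω ≤
        (1 - muF * alpha t) * ‖x t ω - H (y t ω)‖ ^ 4 +
        24 * LH * LGy * beta t * ‖x t ω - H (y t ω)‖ ^ 3 * ‖y t ω - ystar‖ +
        40 * LH ^ 2 * LGy ^ 2 * beta t ^ 2 * ‖x t ω - H (y t ω)‖ ^ 2 * ‖y t ω - ystar‖ ^ 2 +
        1280 * LH ^ 4 * LGy ^ 4 * beta t ^ 4 * ‖y t ω - ystar‖ ^ 4 +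
        32 * alpha t ^ 4 * Γ11 ^ 2 + 224 * LH ^ 4 * beta t ^ 4 * Γ22 ^ 2 +
        (20 * Γ11 * alpha t ^ 2 + 20 * LH ^ 2 * Γ22 * beta t ^ 2 +
            64 * SH ^ 2 * Γ22 ^ (1 + dH) / muF * (beta t ^ (2 + 2 * dH) / alpha t)) *
          ‖x t ω - H (y t ω)‖ ^ 2 := by
  have hxstar : xstar = H ystar := hFHuniq ystar xstar hFroot
  have hGstar : G (H ystar) ystar = 0 := hxstar ▸ hGroot
  have hcoupling : ∀ t, Subsingleton (EuclideanSpace ℝ (Fin dy)) ∨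
      LH * LGx * beta t ≤ muF * alpha t / 200 := by
    intro t
    rcases subsingleton_or_nontrivial (EuclideanSpace ℝ (Fin dy)) with hs | hn
    · exact Or.inl hs
    right
    obtain ⟨y', hy'⟩ := exists_ne ystar
    have hpos : 0 < ‖y' - ystar‖ := norm_pos_iff.2 (sub_ne_zero.2 hy')
    have hGG : muG ≤ LGy := by
      have h1 : muG * ‖y' - ystar‖ ^ 2 ≤ ‖y' - ystar‖ * (LGy * ‖y' - ystar‖) :=
        (hGmono y').trans ((real_inner_le_norm _ _).trans (by gcongr; exact hGlipy y'))
      nlinarith [pow_pos hpos 2]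
    have hα := halpha t
    have hβ := hbeta t
    rcases (mul_nonneg hLH hLGx).eq_or_lt with h0 | h0
    · rw [← h0]
      have := mul_pos hmuF hα
      linarith
    have hM : 200 * muG ≤ max (28 * (dx : ℝ)) (200 * LGy) :=
      le_max_of_le_right (by linarith)
    have hD : 0 < max (28 * (dx : ℝ)) (200 * LGy) * LH * LGx := by
      rw [mul_assoc]; exact mul_pos (by linarith) h0
    have h1 := (hκub t).trans (min_le_left _ _)
    rw [div_le_div_iff₀ hα hD] at h1
    have h2 := mul_le_mul_of_nonneg_right hM (mul_pos hβ h0).le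
    have h3 : muG * (200 * (LH * LGx * beta t)) ≤ muG * (muF * alpha t) := by linarith
    linarith [le_of_mul_le_mul_left h3 hmuG]
  have hreg : ∀ t, StepRegularity F G H H' ystar LH LF LGx LGy muF SH dH (alpha t) (beta t) := by
    intro t
    have hα := halpha t
    refine ⟨hLH, hLF, hLGx, hLGy, hSH, hdH, hmuF, hα, hbeta t, hHlip, fun a b => ?_,
      fun a b => ?_, fun a b => ?_, hH', hHtaylor, ?_, ?_, hcoupling t⟩
    · simpa [hFH] using hFlip a b
    · have h1 := hGlipx a b
      have h2 := hGlipy b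
      rw [hGstar, sub_zero] at h2
      calc ‖G a b‖ = ‖(G a b - G (H b) b) + G (H b) b‖ := by rw [sub_add_cancel]
        _ ≤ _ := (norm_add_le _ _).trans (add_le_add h1 h2)
    · simpa [hFH] using hFmono a b
    · have h1 := (hαub t).trans (min_le_left _ _)
      rcases (mul_nonneg zero_le_four (sq_nonneg LF)).eq_or_lt with h0 | h0
      · rw [← h0, div_zero] at h1
        exact absurd h1 hα.not_ge
      · rw [le_div_iff₀ h0] at h1
        linarith
    · have h1 := (hαub t).trans (min_le_right _ _)
      rw [le_div_iff₀ (by positivity)] at h1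
      linarith
  have hfilt := natFilt_le hx0meas hy0meas hξmeas hψmeas
  have hadapted := measurable_natFilt_iterates hxupd hyupd hFmeas hGmeas
  have hξL : ∀ t, MemLp (ξ t) 4 μ := fun t =>
    (memLp_four_iff (hξmeas t).aestronglyMeasurable).2 (hξ4int t)
  have hψL : ∀ t, MemLp (ψ t) 4 μ := fun t =>
    (memLp_four_iff (hψmeas t).aestronglyMeasurable).2 (hψ4int t)
  have hL : ∀ t, MemLp (x t) 4 μ ∧ MemLp (y t) 4 μ := by
    intro t
    induction t with
    | zero => exact ⟨(memLp_four_iff hx0meas.aestronglyMeasurable).2 hx0L4,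
        (memLp_four_iff hy0meas.aestronglyMeasurable).2 hy0L4⟩
    | succ t ih =>
      have hxy := (hadapted t).mono (hfilt t) le_rfl
      rw [funext (hxupd t), funext (hyupd t)]
      exact (hreg t).memLp_step hFmeas hGmeas hxy.fst hxy.snd ih.1 ih.2 (hξL t) (hψL t)
  intro t
  simp only [hxupd, hyupd]
  filter_upwards [(hreg t).condExp_norm_pow_four_le (hfilt t) hFmeas hGmeas (hadapted t)
    (hL t).1 (hL t).2 (hξL t) (hψL t) hΓ11 hΓ22 (hξmean t) (hψmean t) (hξ4 t) (hψ4 t)] with ω hω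
  refine hω.trans_eq ?_
  have hα := (halpha t).ne'
  field_simp
  ring
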